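/- Let q be a prime power, let C ⊆ F_q^n be a projective linear [n,k]_q code with k ≥ 1 and n ≥ 1 and maximum weight w, and let h ≥ 1 be an integer with q^{k+h−2} > w. Set d = q^{k+h−1} − w, N = (q^{k+h}−1)/(q−1) − n, and n' = ⌈q·d/(q−1)⌉ − q^{k+h−1}. Then there exists a linear code with parameters [N + n', k+h, d]_q that is a minimal code, has maximum weight at least q^{k+h−1} + n', and violates the Ashikhmin-Barg condition, i.e. q·d ≤ (q−1)·(q^{k+h−1} + n'). -/

import Mathlib

open Finset BigOperators

/-- Ceiling division on naturals: `cdiv a b = ⌈a / b⌉`. -/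
def cdiv (a b : ℕ) : ℕ := (a + b - 1) / b

/-- The minimum Hamming weight of a nonzero codeword of a linear code. -/
noncomputable def wmin {F : Type} [Field F] [Fintype F] [DecidableEq F] {n : ℕ}
    (C : Submodule F (Fin n → F)) : ℕ :=
  sInf {w | ∃ c ∈ C, c ≠ (0 : Fin n → F) ∧ hammingNorm c = w}

/-- The maximum Hamming weight of a codeword of a linear code. -/
noncomputable def wmax {F : Type} [Field F] [Fintype F] [DecidableEq F] {n : ℕ}
    (C : Submodule F (Fin n → F)) : ℕ :=
  sSup {w | ∃ c ∈ C, hammingNorm c = w}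

/-- A linear code is minimal if every nonzero codeword `c` is minimal: any codeword `c'`
whose support is contained in the support of `c` is a scalar multiple of `c`. -/
def IsMinimalCode {F : Type} [Field F] [Fintype F] [DecidableEq F] {n : ℕ}
    (C : Submodule F (Fin n → F)) : Prop :=
  ∀ c ∈ C, c ≠ (0 : Fin n → F) → ∀ c' ∈ C,
    {i : Fin n | c' i ≠ 0} ⊆ {i : Fin n | c i ≠ 0} → ∃ l : F, c' = l • c

/-- A linear code is self-orthogonal if the standard inner product of any two codewords is 0. -/
def SelfOrthogonal {F : Type} [Field F] {n : ℕ} (C : Submodule F (Fin n → F)) : Prop :=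
  ∀ c ∈ C, ∀ c' ∈ C, ∑ i, c i * c' i = 0

/-- A linear `[n,k]_q` code is projective if it is the image of `x ↦ (x·g_1, …, x·g_n)` for
nonzero, pairwise linearly independent vectors `g_1, …, g_n ∈ F_q^k`. -/
def IsProjectiveCode {F : Type} [Field F] {n : ℕ} (k : ℕ) (C : Submodule F (Fin n → F)) : Prop :=
  ∃ g : Fin n → (Fin k → F),
    (∀ i, g i ≠ 0) ∧
    (∀ i j, i ≠ j → ∀ l : F, g i ≠ l • g j) ∧
    (C : Set (Fin n → F)) = {c | ∃ x : Fin k → F, c = fun i => ∑ t, x t * g i t}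

/-- `Aw C w` is the number of codewords of `C` of Hamming weight `w`. -/
noncomputable def Aw {F : Type} [Field F] [Fintype F] [DecidableEq F] {n : ℕ}
    (C : Submodule F (Fin n → F)) (w : ℕ) : ℕ :=
  Set.ncard {c : Fin n → F | c ∈ C ∧ hammingNorm c = w}

open scoped LinearAlgebra.Projectivization

section Counting

variable {F V : Type*} [Field F] [Fintype F] [AddCommGroup V] [Module F V]
  [FiniteDimensional F V]

/-- An affine hyperplane missing the origin has `q ^ (dim V - 1)` points. -/
lemma card_dual_apply_eq_one {φ : Module.Dual F V} (hφ : φ ≠ 0) :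
    Nat.card {v // φ v = 1} = Fintype.card F ^ (Module.finrank F V - 1) := by
  obtain ⟨v₀, hv₀⟩ : ∃ v, φ v = 1 := (LinearMap.surjective hφ) 1
  let e : {v // φ v = 1} ≃ LinearMap.ker φ :=
    (Equiv.subRight v₀).subtypeEquiv fun v => by
      simp [hv₀, sub_eq_zero]
  have hker := Module.Dual.finrank_ker_add_one_of_ne_zero hφ
  rw [Nat.card_congr e, Module.natCard_eq_pow_finrank (K := F), Nat.card_eq_fintype_card, ← hker,
    Nat.add_sub_cancel]

omit [Fintype F] [FiniteDimensional F V] in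
lemma dual_rep_mk_ne_zero_iff (φ : Module.Dual F V) {v : V} (hv : v ≠ 0) :
    φ (Projectivization.mk F v hv).rep ≠ 0 ↔ φ v ≠ 0 := by
  obtain ⟨a, ha⟩ := Projectivization.exists_smul_eq_mk_rep F v hv
  rw [← ha, Units.smul_def, map_smul, smul_eq_mul]
  simp

/-- The complement of a hyperplane in projective space has `q ^ (dim V - 1)` points. -/
lemma card_projectivization_dual_rep_ne_zero {φ : Module.Dual F V} (hφ : φ ≠ 0) :
    Nat.card {p : ℙ F V // φ p.rep ≠ 0} = Fintype.card F ^ (Module.finrank F V - 1) := by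
  rw [← card_dual_apply_eq_one hφ]
  symm
  have hne (v : {v // φ v = 1}) : v.1 ≠ 0 := fun h0 => by simpa [h0] using v.2
  let f : {v // φ v = 1} → {p : ℙ F V // φ p.rep ≠ 0} := fun v =>
    ⟨Projectivization.mk F v.1 (hne v), by
      rw [dual_rep_mk_ne_zero_iff, v.2]
      exact one_ne_zero⟩
  refine Nat.card_eq_of_bijective f ⟨fun v u huv => ?_, fun p => ?_⟩
  · obtain ⟨a, ha⟩ := (Projectivization.mk_eq_mk_iff' F _ _ (hne v) (hne u)).1
      (congrArg Subtype.val huv)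
    have ha1 : a = 1 := by simpa [u.2, v.2] using congrArg φ ha
    exact Subtype.ext (by rw [← ha, ha1, one_smul])
  · refine ⟨⟨(φ p.1.rep)⁻¹ • p.1.rep, by simp [p.2]⟩, Subtype.ext ?_⟩
    conv_rhs => rw [← p.1.mk_rep]
    exact (Projectivization.mk_eq_mk_iff' F _ _ _ _).2 ⟨_, rfl⟩

variable [DecidableEq F]

/-- The weights of a functional on a set of projective points and on its complement add up to
`q ^ (dim V - 1)`. -/
lemma hammingNorm_compl_add_hammingNorm {n N : ℕ} {P : Fin n → ℙ F V}
    (hP : Function.Injective P) (e : Fin N ≃ ((Set.range P)ᶜ : Set (ℙ F V)))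
    {φ : Module.Dual F V} (hφ : φ ≠ 0) :
    hammingNorm (fun i => φ (e i).1.rep) + hammingNorm (fun i => φ (P i).rep) =
      Fintype.card F ^ (Module.finrank F V - 1) := by
  classical
  have : Finite V := Module.finite_of_finite F
  have : Fintype (ℙ F V) := Fintype.ofFinite _
  rw [← card_projectivization_dual_rep_ne_zero hφ, Nat.card_eq_fintype_card,
    Fintype.card_subtype]
  let E : Fin n ⊕ Fin N ≃ ℙ F V :=
    (Equiv.sumCongr (Equiv.ofInjective P hP) e).trans (Equiv.Set.sumCompl _)
  simp only [hammingNorm, Finset.card_filter]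
  rw [← E.sum_comp, Fintype.sum_sum_type, add_comm]
  rfl

omit [FiniteDimensional F V] [Fintype F] in
lemma hammingNorm_finAppend {a b : ℕ} (x : Fin a → F) (y : Fin b → F) :
    hammingNorm (Fin.append x y) = hammingNorm x + hammingNorm y := by
  simp [hammingNorm, Finset.card_filter, Fin.sum_univ_add]

/-- If the weights on a projective system `P` are smaller than `q ^ (dim V - 2)`, then two
independent functionals are separated by a point outside of `P`. -/
lemma exists_notMem_range_separating {n w : ℕ} {P : Fin n → ℙ F V}
    (hPw : ∀ φ : Module.Dual F V, hammingNorm (fun i => φ (P i).rep) ≤ w)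
    (hw : w < Fintype.card F ^ (Module.finrank F V - 2)) {φ ψ : Module.Dual F V} (hφ : φ ≠ 0)
    (hψ : ∀ l : F, ψ ≠ l • φ) :
    ∃ p ∉ Set.range P, φ p.rep = 0 ∧ ψ p.rep ≠ 0 := by
  by_contra! H
  let χ : Module.Dual F (LinearMap.ker φ) := ψ.domRestrict (LinearMap.ker φ)
  have hχ : χ ≠ 0 := fun h0 => by
    have hmem : ψ ∈ Submodule.span F (Set.range fun _ : Unit => φ) := by
      refine mem_span_of_iInf_ker_le_ker fun v hv => ?_
      have hv' : v ∈ LinearMap.ker φ := by simpa using hv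
      exact LinearMap.congr_fun h0 ⟨v, hv'⟩
    rw [Set.range_const, Submodule.mem_span_singleton] at hmem
    obtain ⟨l, hl⟩ := hmem
    exact hψ l hl.symm
  have hker := Module.Dual.finrank_ker_add_one_of_ne_zero hφ
  have hcard := card_dual_apply_eq_one hχ
  have hne (v : {v // χ v = 1}) : (v.1 : V) ≠ 0 := fun h0 => by
    have := v.2
    rw [show v.1 = 0 from Subtype.ext h0, map_zero] at this
    exact zero_ne_one this
  have hψv (v : {v // χ v = 1}) : ψ v.1 = 1 := v.2
  have hcover (v : {v // χ v = 1}) : ∃ i, P i = Projectivization.mk F (v.1 : V) (hne v) := by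
    by_contra! hv
    refine (dual_rep_mk_ne_zero_iff ψ (hne v)).2 (by simp [hψv v]) (H _ ?_ ?_)
    · rintro ⟨i, hi⟩
      exact hv i hi
    · by_contra h0
      exact (dual_rep_mk_ne_zero_iff φ (hne v)).1 h0 v.1.2
  choose f hf using hcover
  have hfψ (v : {v // χ v = 1}) : ψ (P (f v)).rep ≠ 0 := by
    rw [hf, dual_rep_mk_ne_zero_iff, hψv]
    exact one_ne_zero
  have hle := Nat.card_le_card_of_injective
    (fun v => (⟨f v, hfψ v⟩ : {i // ψ (P i).rep ≠ 0})) fun v u huv => by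
      have hfe : f v = f u := congrArg Subtype.val huv
      obtain ⟨a, ha⟩ := (Projectivization.mk_eq_mk_iff' F _ _ (hne v) (hne u)).1
        ((hf v).symm.trans ((congrArg P hfe).trans (hf u)))
      have ha1 : a = 1 := by simpa [hψv] using congrArg ψ ha
      exact Subtype.ext (Subtype.ext (by rw [← ha, ha1, one_smul]))
  have hnorm : Nat.card {i // ψ (P i).rep ≠ 0} = hammingNorm fun i => ψ (P i).rep := by
    rw [Nat.card_eq_fintype_card, Fintype.card_subtype]
    rfl
  rw [hnorm, hcard, show Module.finrank F (LinearMap.ker φ) - 1 = Module.finrank F V - 2 by omega]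
    at hle
  exact absurd (hle.trans (hPw ψ)) (not_le.2 hw)

end Counting

section Anticode

variable {F V : Type} [Field F] [Fintype F] [DecidableEq F] [AddCommGroup V] [Module F V]
  [FiniteDimensional F V]

lemma hammingNorm_le_wmax {n : ℕ} {C : Submodule F (Fin n → F)} {c : Fin n → F} (hc : c ∈ C) :
    hammingNorm c ≤ wmax C :=
  le_csSup ⟨n, by
    rintro _ ⟨c, -, rfl⟩
    simpa using hammingNorm_le_card_fintype (x := c)⟩ ⟨c, hc, rfl⟩

lemma exists_hammingNorm_eq_wmax {n : ℕ} (C : Submodule F (Fin n → F)) :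
    ∃ c ∈ C, hammingNorm c = wmax C :=
  Nat.sSup_mem (s := {w | ∃ c ∈ C, hammingNorm c = w}) ⟨_, 0, C.zero_mem, rfl⟩ ⟨n, by
    rintro _ ⟨c, -, rfl⟩
    simpa using hammingNorm_le_card_fintype (x := c)⟩

/-- The code of all points outside a projective system `P` of small maximum weight, followed by
`r` copies of a vector `v₀`, is minimal. -/
lemma exists_minimalCode_of_anticode {n N r w : ℕ} {P : Fin n → ℙ F V}
    (hP : Function.Injective P) (hN : Nat.card (ℙ F V) - n = N)
    (hPw : ∀ φ : Module.Dual F V, hammingNorm (fun i => φ (P i).rep) ≤ w)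
    (hw : w < Fintype.card F ^ (Module.finrank F V - 2)) (v₀ : V) {φ₀ φ₁ : Module.Dual F V}
    (hφ₀ : φ₀ ≠ 0) (hφ₀w : hammingNorm (fun i => φ₀ (P i).rep) = w) (hφ₀v : φ₀ v₀ = 0)
    (hφ₁w : hammingNorm (fun i => φ₁ (P i).rep) = 0) (hφ₁v : φ₁ v₀ ≠ 0) :
    ∃ D : Submodule F (Fin (N + r) → F),
      Module.finrank F D = Module.finrank F V ∧
      wmin D = Fintype.card F ^ (Module.finrank F V - 1) - w ∧
      IsMinimalCode D ∧
      wmax D ≥ Fintype.card F ^ (Module.finrank F V - 1) + r := by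
  have : Finite V := Module.finite_of_finite F
  have hcompl : Nat.card ((Set.range P)ᶜ : Set (ℙ F V)) = N := by
    rw [Nat.card_coe_set_eq, Set.ncard_compl, ← Nat.card_coe_set_eq (Set.range P),
      Nat.card_range_of_injective hP, Nat.card_fin, hN]
  let e : Fin N ≃ ((Set.range P)ᶜ : Set (ℙ F V)) := (Finite.equivFinOfCardEq hcompl).symm
  let L : Module.Dual F V →ₗ[F] (Fin (N + r) → F) := LinearMap.pi fun i =>
    Module.Dual.eval F V (Fin.append (fun i => (e i).1.rep) (fun _ => v₀) i)
  have hL (φ : Module.Dual F V) :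
      L φ = Fin.append (fun i => φ (e i).1.rep) (fun _ => φ v₀) := by
    funext i
    refine Fin.addCases (fun i => ?_) (fun i => ?_) i <;> simp [L]
  have hnorm (φ : Module.Dual F V) (hφ : φ ≠ 0) : hammingNorm (L φ) +
      hammingNorm (fun i => φ (P i).rep) =
      Fintype.card F ^ (Module.finrank F V - 1) + hammingNorm (fun _ : Fin r => φ v₀) := by
    rw [hL, hammingNorm_finAppend, ← hammingNorm_compl_add_hammingNorm hP e hφ]
    ring
  have hpow : Fintype.card F ^ (Module.finrank F V - 2) ≤
      Fintype.card F ^ (Module.finrank F V - 1) :=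
    Nat.pow_le_pow_right Fintype.card_pos (by omega)
  have hmin (φ : Module.Dual F V) (hφ : φ ≠ 0) :
      Fintype.card F ^ (Module.finrank F V - 1) - w ≤ hammingNorm (L φ) := by
    have := hnorm φ hφ
    have := hPw φ
    omega
  have hinj : Function.Injective L := (injective_iff_map_eq_zero L).2 fun φ h0 => by
    by_contra hφ
    have := hmin φ hφ
    rw [h0, hammingNorm_zero] at this
    omega
  refine ⟨LinearMap.range L, ?_, ?_, ?_, ?_⟩
  · rw [LinearMap.finrank_range_of_inj hinj, Subspace.dual_finrank_eq]
  · refine IsLeast.csInf_eq ⟨⟨L φ₀, ⟨φ₀, rfl⟩, ?_, ?_⟩, ?_⟩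
    · exact (map_ne_zero_iff L hinj).2 hφ₀
    · have h0 := hnorm φ₀ hφ₀
      rw [hφ₀w, hφ₀v, show (fun _ : Fin r => (0 : F)) = 0 from rfl, hammingNorm_zero] at h0
      omega
    · rintro _ ⟨_, ⟨φ, rfl⟩, hne, rfl⟩
      exact hmin φ fun h0 => hne (by rw [h0, map_zero])
  · rintro _ ⟨φ, rfl⟩ hne _ ⟨ψ, rfl⟩ hsub
    by_contra! hψ
    obtain ⟨p, hp, hφp, hψp⟩ := exists_notMem_range_separating hPw hw (φ := φ) (ψ := ψ)
      (fun h0 => hne (by rw [h0, map_zero])) fun l hl => hψ l (by rw [hl, map_smul])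
    have hval (χ : Module.Dual F V) : L χ (Fin.castAdd r (e.symm ⟨p, hp⟩)) = χ p.rep := by
      simp [hL]
    have hmem := @hsub (Fin.castAdd r (e.symm ⟨p, hp⟩))
    simp only [Set.mem_ofPred_eq, hval] at hmem
    exact hmem hψp hφp
  · have hφ₁ : φ₁ ≠ 0 := fun h0 => hφ₁v (by simp [h0])
    have h1 := hnorm φ₁ hφ₁
    have hr : hammingNorm (fun _ : Fin r => φ₁ v₀) = r := by simp [hammingNorm, hφ₁v]
    rw [hφ₁w, hr] at h1
    exact (ge_of_eq h1).trans (hammingNorm_le_wmax ⟨φ₁, rfl⟩)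

end Anticode

lemma le_mul_cdiv {a b : ℕ} (hb : 0 < b) : a ≤ b * cdiv a b := by
  have h1 := Nat.div_add_mod (a + b - 1) b
  have h2 := Nat.mod_lt (a + b - 1) hb
  unfold cdiv
  omega

/-- Corollary 3.1. A minimal code violating the Ashikhmin-Barg condition from an
arbitrary projective linear code. -/
theorem minimal_code_violating_AB_from_projective
    {F : Type} [Field F] [Fintype F] [DecidableEq F] {n k : ℕ}
    (hk : 1 ≤ k) (hn : 1 ≤ n)
    (C : Submodule F (Fin n → F)) (hdim : Module.finrank F C = k)
    (hproj : IsProjectiveCode k C)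
    (w : ℕ) (hw : w = wmax C)
    (h : ℕ) (hh : 1 ≤ h) (hcond : Fintype.card F ^ (k + h - 2) > w)
    (d N n' : ℕ)
    (hd : d = Fintype.card F ^ (k + h - 1) - w)
    (hN : N = (Fintype.card F ^ (k + h) - 1) / (Fintype.card F - 1) - n)
    (hn' : n' = cdiv (Fintype.card F * d) (Fintype.card F - 1)
        - Fintype.card F ^ (k + h - 1)) :
    ∃ D : Submodule F (Fin (N + n') → F),
      Module.finrank F D = k + h ∧
      wmin D = d ∧
      IsMinimalCode D ∧
      wmax D ≥ Fintype.card F ^ (k + h - 1) + n' ∧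
      Fintype.card F * d ≤ (Fintype.card F - 1) * (Fintype.card F ^ (k + h - 1) + n') := by
  obtain ⟨g, hg0, hgind, hgC⟩ := hproj
  have hC (x : Fin k → F) : (fun i => ∑ t, x t * g i t) ∈ C :=
    (Set.ext_iff.1 hgC _).2 ⟨x, rfl⟩
  let V := (Fin k → F) × (Fin h → F)
  have hV : Module.finrank F V = k + h := by simp [V]
  have hcardV : Nat.card V = Fintype.card F ^ (k + h) := by
    rw [Module.natCard_eq_pow_finrank (K := F), hV, Nat.card_eq_fintype_card]
  have hg (i : Fin n) : ((g i, 0) : V) ≠ 0 := fun h0 => hg0 i (congrArg Prod.fst h0)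
  let P : Fin n → ℙ F V := fun i => Projectivization.mk F (g i, 0) (hg i)
  have hP : Function.Injective P := fun i j hij => by
    by_contra hne
    obtain ⟨a, ha⟩ := (Projectivization.mk_eq_mk_iff' F _ _ (hg i) (hg j)).1 hij
    exact hgind i j hne a (congrArg Prod.fst ha).symm
  have hnorm (φ : Module.Dual F V) :
      hammingNorm (fun i => φ (P i).rep) = hammingNorm (fun i => φ (g i, 0)) := by
    unfold hammingNorm
    congr 1
    ext i
    simp only [Finset.mem_filter, Finset.mem_univ, true_and]
    exact dual_rep_mk_ne_zero_iff φ (hg i)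
  have hPw (φ : Module.Dual F V) : hammingNorm (fun i => φ (P i).rep) ≤ w := by
    rw [hnorm, hw]
    refine hammingNorm_le_wmax ?_
    convert hC (fun t => φ (Pi.single t 1, 0)) using 2 with i
    refine (LinearMap.pi_apply_eq_sum_univ
      (φ ∘ₗ LinearMap.inl F (Fin k → F) (Fin h → F)) (g i)).trans ?_
    refine Finset.sum_congr rfl fun t _ => ?_
    rw [smul_eq_mul, mul_comm, LinearMap.comp_apply, LinearMap.inl_apply]
    congr 3
    funext j
    simp [Pi.single_apply, eq_comm]
  obtain ⟨c, hcC, hcw⟩ := exists_hammingNorm_eq_wmax C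
  obtain ⟨x, rfl⟩ := (Set.ext_iff.1 hgC c).1 hcC
  let φ₀ : Module.Dual F V :=
    (∑ t, x t • LinearMap.proj t) ∘ₗ LinearMap.fst F (Fin k → F) (Fin h → F)
  have hφ₀_apply (v : V) : φ₀ v = ∑ t, x t * v.1 t := by
    simp [φ₀]
    rfl
  have hφ₀w : hammingNorm (fun i => φ₀ (P i).rep) = w := by
    rw [hnorm, hw, ← hcw]
    simp only [hφ₀_apply]
  have hwpos : w ≠ 0 := by
    obtain ⟨t, ht⟩ := Function.ne_iff.1 (hg0 ⟨0, hn⟩)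
    have hle := hammingNorm_le_wmax (hC (Pi.single t 1))
    have hpos : 0 < hammingNorm (fun i => ∑ s, (Pi.single t 1 : Fin k → F) s * g i s) :=
      hammingNorm_pos_iff.2 fun h0 => ht (by simpa [Pi.single_apply] using congrFun h0 ⟨0, hn⟩)
    omega
  have hφ₀ : φ₀ ≠ 0 := fun h0 => hwpos (by
    rw [← hφ₀w, h0]
    exact hammingNorm_zero)
  let φ₁ : Module.Dual F V :=
    LinearMap.proj ⟨0, hh⟩ ∘ₗ LinearMap.snd F (Fin k → F) (Fin h → F)
  have hφ₁w : hammingNorm (fun i => φ₁ (P i).rep) = 0 := by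
    rw [hnorm]
    exact hammingNorm_zero
  have hcard : Nat.card (ℙ F V) - n = N := by
    rw [Projectivization.card'', hcardV, Nat.card_eq_fintype_card, hN]
  obtain ⟨D, hD, hDmin, hDminimal, hDmax⟩ := exists_minimalCode_of_anticode (r := n') hP hcard hPw
    (by rwa [hV]) (0, 1) hφ₀ hφ₀w (by simp [hφ₀_apply]) hφ₁w one_ne_zero
  rw [hV] at hD hDmin hDmax
  refine ⟨D, hD, hDmin.trans hd.symm, hDminimal, hDmax, ?_⟩
  have hq : 0 < Fintype.card F - 1 := Nat.sub_pos_of_lt Fintype.one_lt_card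
  exact (le_mul_cdiv hq).trans (Nat.mul_le_mul_left _ (by omega))
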